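/- arXiv:1112.1183 — 5 statements merged into one kernel-verified Lean document; each statement's English description precedes it below -/
import Mathlib

section
/- Let a_1 a_2 ⋯ be a sequence of non-negative integers and n ≥ 2. For all x ≠ 0, P'_n(x) = (−1)^n x^{n−1} (1 + Σ_{j=1}^{n−1} P_j(x)/(−x)^j). Moreover, if x ∈ J_{n−1} and x ≥ (1+√5)/2, then (−1)^n P'_n(x) > 0; in particular P_n is strictly increasing on J_{n−1} ∩ [(1+√5)/2, ∞) when n is even and strictly decreasing there when n is odd. -/
open Filter Set

/-- The (−β)-transformation on [−β/(β+1), 1/(β+1)). -/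
noncomputable def negBetaT (β : ℝ) (x : ℝ) : ℝ := -β * x - ⌊β / (β + 1) - β * x⌋

/-- The digits of the (−β)-expansion of x; `negBetaDigit β x n` is ε_{n+1}(x). -/
noncomputable def negBetaDigit (β : ℝ) (x : ℝ) (n : ℕ) : ℤ :=
  ⌊β / (β + 1) - β * ((negBetaT β)^[n] x)⌋

/-- The (−β)-expansion of the left endpoint −β/(β+1); index n represents a_{n+1}. -/
noncomputable def negBetaExp (β : ℝ) (n : ℕ) : ℤ := negBetaDigit β (-β / (β + 1)) n

/-- `b` is the (−β)-expansion of `x`. -/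
def IsNegBetaExpOf (β : ℝ) (x : ℝ) (b : ℕ → ℤ) : Prop :=
  x ∈ Set.Ico (-β / (β + 1)) (1 / (β + 1)) ∧ ∀ n, b n = negBetaDigit β x n

/-- Alternating lexicographic strict order (0-based indexing: index k corresponds
to position k+1, so `Even k` means odd position). -/
def AltLt (x y : ℕ → ℤ) : Prop :=
  ∃ k, (∀ i, i < k → x i = y i) ∧ (if Even k then x k < y k else y k < x k)

/-- Alternating lexicographic order. -/
def AltLe (x y : ℕ → ℤ) : Prop := AltLt x y ∨ x = y

def phiW : ℕ → List ℕ
  | 1 => [1, 0, 0]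
  | _ => [1]

/-- `uWord n` is φ^n(1), where φ(1) = 100, φ(0) = 1. -/
def uWord : ℕ → List ℕ
  | 0 => [1]
  | n + 1 => (uWord n).flatMap phiW

/-- The sequence u = 100111001001001110011⋯ starting with φ^n(1) for all n. -/
def uSeq (n : ℕ) : ℤ := ((uWord (n + 1)).getD n 0 : ℕ)

/-- Condition (G): every shifted sequence is ≤_alt the sequence itself. -/
def CondG (a : ℕ → ℤ) : Prop := ∀ k, 1 ≤ k → AltLe (fun n => a (n + k)) a

/-- Condition (L): a >_alt u. -/
def CondL (a : ℕ → ℤ) : Prop := AltLt uSeq a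

/-- The periodic sequence (w)^∞. -/
def perSeq (w : List ℤ) : ℕ → ℤ := fun n => w.getD (n % w.length) 0

/-- `a` is an infinite concatenation of blocks from `S`. -/
def IsInfConcat (S : Set (List ℤ)) (a : ℕ → ℤ) : Prop :=
  ∃ w : ℕ → List ℤ, (∀ n, w n ∈ S) ∧
    ∀ N i, i < (((List.range N).map w).flatten).length →
      (((List.range N).map w).flatten).getD i 0 = a i

/-- Condition (A1). -/
def CondA1 (a : ℕ → ℤ) : Prop :=
  ∀ k, 1 ≤ k → AltLt uSeq (perSeq ((List.range k).map a)) →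
    IsInfConcat {(List.range k).map a, (List.range (k - 1)).map a ++ [a (k - 1) - 1, 0]} a →
    a = perSeq ((List.range k).map a)

/-- Condition (A2). -/
def CondA2 (a : ℕ → ℤ) : Prop :=
  ∀ k, 1 ≤ k → AltLt uSeq (perSeq ((List.range (k - 1)).map a ++ [a (k - 1) + 1])) →
    ¬ IsInfConcat {(List.range k).map a ++ [0], (List.range (k - 1)).map a ++ [a (k - 1) + 1]} a

/-- The cylinder set I_{b_1⋯b_n}. -/
def cylinder (β : ℝ) (w : List ℤ) : Set ℝ :=
  {x | x ∈ Set.Ico (-β / (β + 1)) (1 / (β + 1)) ∧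
    ∀ i, i < w.length → negBetaDigit β x i = w.getD i 0}

/-- L_{β,n}: the number of words of length n with nonempty cylinder. -/
noncomputable def Lnum (β : ℝ) (n : ℕ) : ℕ :=
  Set.ncard {w : List ℤ | w.length = n ∧ (cylinder β w).Nonempty}

/-- L'_{β,n}: the number of words of length n whose cylinder is an interval of
positive length. -/
noncomputable def Lnum' (β : ℝ) (n : ℕ) : ℕ :=
  Set.ncard {w : List ℤ | w.length = n ∧
    ∃ c d : ℝ, c < d ∧ Set.Ioo c d ⊆ cylinder β w ∧ cylinder β w ⊆ Set.Icc c d}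

/-- P_n(x) = (−x)^n + Σ_{j=1}^n (a_j+1)(−x)^{n−j}. -/
noncomputable def Pn (a : ℕ → ℤ) (n : ℕ) (x : ℝ) : ℝ :=
  (-x) ^ n + ∑ j ∈ Finset.range n, ((a j : ℝ) + 1) * (-x) ^ (n - 1 - j)

/-- J_n = {x > 1 : P_j(x) ∈ [0,1] for all 1 ≤ j ≤ n}. -/
def Jn (a : ℕ → ℤ) (n : ℕ) : Set ℝ :=
  {x | 1 < x ∧ ∀ j, 1 ≤ j → j ≤ n → Pn a j x ∈ Set.Icc (0 : ℝ) 1}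

theorem Pn_zero (a : ℕ → ℤ) (x : ℝ) : Pn a 0 x = 1 := by simp [Pn]

theorem Pn_succ (a : ℕ → ℤ) (n : ℕ) (x : ℝ) :
    Pn a (n + 1) x = -x * Pn a n x + ((a n : ℝ) + 1) := by
  have h : ∑ j ∈ Finset.range n, ((a j : ℝ) + 1) * (-x) ^ (n - j) =
      -x * ∑ j ∈ Finset.range n, ((a j : ℝ) + 1) * (-x) ^ (n - 1 - j) := by
    rw [Finset.mul_sum]
    refine Finset.sum_congr rfl fun j hj => ?_
    have hj' := Finset.mem_range.mp hj
    rw [show n - j = n - 1 - j + 1 by omega, pow_succ]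
    ring
  simp only [Pn, Finset.sum_range_succ, Nat.add_sub_cancel, h, Nat.sub_self, pow_zero, pow_succ]
  ring

theorem hasDerivAt_Pn_succ (a : ℕ → ℤ) (n : ℕ) {x : ℝ} (hx : x ≠ 0) :
    HasDerivAt (Pn a (n + 1)) ((-1) ^ (n + 1) * x ^ n *
      (1 + ∑ j ∈ Finset.range n, Pn a (j + 1) x / (-x) ^ (j + 1))) x := by
  induction n with
  | zero =>
    have h : Pn a 1 = fun y => -y + ((a 0 : ℝ) + 1) := by
      funext y
      rw [Pn_succ, Pn_zero, mul_one]
    rw [h]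
    simpa using (hasDerivAt_id x).neg.add_const ((a 0 : ℝ) + 1)
  | succ n ih =>
    have h : Pn a (n + 1 + 1) = fun y => -y * Pn a (n + 1) y + ((a (n + 1) : ℝ) + 1) :=
      funext (Pn_succ a (n + 1))
    rw [h]
    refine (((hasDerivAt_id x).neg.mul ih).add_const ((a (n + 1) : ℝ) + 1)).congr_deriv ?_
    have hcancel : (-1) ^ (n + 1) * x ^ (n + 1) *
        (Pn a (n + 1) x / (-x) ^ (n + 1)) = Pn a (n + 1) x := by
      rw [← mul_pow, neg_one_mul, mul_div_cancel₀ _ (pow_ne_zero _ (neg_ne_zero.mpr hx))]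
    rw [Finset.sum_range_succ]
    simp only [Pi.neg_apply, id_eq]
    linear_combination hcancel

theorem continuous_Pn (a : ℕ → ℤ) (n : ℕ) : Continuous (Pn a n) := by
  unfold Pn
  fun_prop

/-- Lower bound for alternating sums with coefficients in `[0, 1]`: they exceed `-1` as soon as
the ratio `y` is at most the inverse golden ratio. -/
theorem neg_one_lt_sum_mul_neg_pow {y : ℝ} (hy : 0 < y) (hy' : y + y ^ 2 ≤ 1) (p : ℕ → ℝ) (m : ℕ)
    (hp : ∀ j < m, p j ∈ Set.Icc (0 : ℝ) 1) :
    -1 < ∑ j ∈ Finset.range m, p j * (-y) ^ (j + 1) := by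
  have key : (Even m → -1 + y ^ m ≤ ∑ j ∈ Finset.range m, p j * (-y) ^ (j + 1)) ∧
      (Odd m → -1 + y ^ (m + 1) ≤ ∑ j ∈ Finset.range m, p j * (-y) ^ (j + 1)) := by
    induction m with
    | zero => simp
    | succ m ih =>
      obtain ⟨hE, hO⟩ := ih fun j hj => hp j (by omega)
      obtain ⟨h0, h1⟩ := hp m (by omega)
      rw [Finset.sum_range_succ]
      have hpow : 0 < y ^ (m + 1) := pow_pos hy _
      constructor
      · intro hm
        have := hO (by grind)
        rw [hm.neg_pow]
        nlinarith [mul_nonneg h0 hpow.le]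
      · intro hm
        have := hE (by grind)
        rw [hm.neg_pow]
        have hstep : y ^ (m + 1) + y ^ (m + 1 + 1) ≤ y ^ m := by
          have := mul_le_mul_of_nonneg_left hy' (pow_pos hy m).le
          rw [pow_succ, pow_succ, pow_succ]
          linarith
        nlinarith [mul_le_mul_of_nonneg_right h1 hpow.le]
  rcases Nat.even_or_odd m with h | h
  · linarith [key.1 h, pow_pos hy m]
  · linarith [key.2 h, pow_pos hy (m + 1)]

theorem neg_one_pow_mul_deriv_Pn_pos (a : ℕ → ℤ) (n : ℕ) {x : ℝ} (hx : x ∈ Jn a n)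
    (hφ : (1 + Real.sqrt 5) / 2 ≤ x) : 0 < (-1) ^ (n + 1) * deriv (Pn a (n + 1)) x := by
  have hx0 : 0 < x := one_pos.trans hx.1
  have hquad : x + 1 ≤ x ^ 2 := by
    have h5 : Real.sqrt 5 ^ 2 = 5 := Real.sq_sqrt (by norm_num)
    nlinarith [Real.sqrt_nonneg 5]
  have hinv : x⁻¹ + x⁻¹ ^ 2 ≤ 1 := by
    rw [show x⁻¹ + x⁻¹ ^ 2 = (x + 1) / x ^ 2 by field_simp]
    exact (div_le_one (by positivity)).mpr hquad
  have hsum := neg_one_lt_sum_mul_neg_pow (inv_pos.mpr hx0) hinv (fun j => Pn a (j + 1) x) n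
    fun j hj => hx.2 (j + 1) (by omega) (by omega)
  simp only [← inv_neg, inv_pow, ← div_eq_mul_inv] at hsum
  rw [(hasDerivAt_Pn_succ a n hx0.ne').deriv, ← mul_assoc, ← mul_assoc, ← mul_pow, neg_one_mul,
    neg_neg, one_pow, one_mul]
  exact mul_pos (pow_pos hx0 n) (by linarith)

theorem strictMonoOn_neg_one_pow_mul_Pn (a : ℕ → ℤ) (n : ℕ) {s : Set ℝ} (hs : Convex ℝ s)
    (hsJ : s ⊆ Jn a n ∩ Set.Ici ((1 + Real.sqrt 5) / 2)) :
    StrictMonoOn (fun x => (-1) ^ (n + 1) * Pn a (n + 1) x) s := by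
  refine strictMonoOn_of_deriv_pos hs ((continuous_Pn a (n + 1)).const_mul _).continuousOn
    fun x hx => ?_
  have hx' := hsJ (interior_subset hx)
  have hd := (hasDerivAt_Pn_succ a n (one_pos.trans hx'.1.1).ne').differentiableAt
  rw [deriv_const_mul _ hd]
  exact neg_one_pow_mul_deriv_Pn_pos a n hx'.1 hx'.2

theorem ordConnected_Jn_inter_Ici (a : ℕ → ℤ) (n : ℕ) :
    (Jn a n ∩ Set.Ici ((1 + Real.sqrt 5) / 2)).OrdConnected := by
  induction n with
  | zero =>
    have h : Jn a 0 = Set.Ioi 1 := by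
      ext x
      simp only [Jn, Set.mem_ofPred_eq, Set.mem_Ioi, and_iff_left_iff_imp]
      intro _ j h1 h0
      omega
    rw [h]
    infer_instance
  | succ n ih =>
    have hmono := (strictMonoOn_neg_one_pow_mul_Pn a n ih.convex subset_rfl).monotoneOn
    have hsub : Jn a (n + 1) ⊆ Jn a n := fun x hx => ⟨hx.1, fun j h1 hj => hx.2 j h1 (by omega)⟩
    refine ⟨fun x hx y hy z hz => ?_⟩
    have hx' := Set.inter_subset_inter_left _ hsub hx
    have hy' := Set.inter_subset_inter_left _ hsub hy
    have hz' := ih.out hx' hy' hz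
    have hxz := hmono hx' hz' hz.1
    have hzy := hmono hz' hy' hz.2
    have hPx := hx.1.2 (n + 1) (by omega) le_rfl
    have hPy := hy.1.2 (n + 1) (by omega) le_rfl
    refine ⟨⟨hz'.1.1, fun j h1 hj => ?_⟩, hz'.2⟩
    rcases Nat.lt_or_ge n j with h | h
    · obtain rfl : j = n + 1 := by omega
      rcases neg_one_pow_eq_or ℝ (n + 1) with hs | hs <;> simp only [hs] at hxz hzy <;>
        constructor <;> linarith [hPx.1, hPx.2, hPy.1, hPy.2]
    · exact hz'.1.2 j h1 h

/-- the derivative formula for P_n, positivity of (−1)^n P'_n on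
J_{n−1} ∩ [(1+√5)/2, ∞), and the resulting strict monotonicity. -/
theorem stmt_15 (a : ℕ → ℤ) (hpos : ∀ n, 0 ≤ a n) (n : ℕ) (hn : 2 ≤ n) :
    (∀ x : ℝ, x ≠ 0 → deriv (Pn a n) x =
      (-1) ^ n * x ^ (n - 1) *
        (1 + ∑ j ∈ Finset.range (n - 1), Pn a (j + 1) x / (-x) ^ (j + 1))) ∧
    (∀ x ∈ Jn a (n - 1), (1 + Real.sqrt 5) / 2 ≤ x →
      0 < (-1) ^ n * deriv (Pn a n) x) ∧
    (Even n → StrictMonoOn (Pn a n) (Jn a (n - 1) ∩ Set.Ici ((1 + Real.sqrt 5) / 2))) ∧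
    (Odd n → StrictAntiOn (Pn a n) (Jn a (n - 1) ∩ Set.Ici ((1 + Real.sqrt 5) / 2))) := by
  obtain ⟨m, rfl⟩ : ∃ m, n = m + 1 := ⟨n - 1, by omega⟩
  simp only [Nat.add_sub_cancel]
  have hmono :=
    strictMonoOn_neg_one_pow_mul_Pn a m (ordConnected_Jn_inter_Ici a m).convex subset_rfl
  refine ⟨fun x hx => (hasDerivAt_Pn_succ a m hx).deriv,
    fun x hx hφ => neg_one_pow_mul_deriv_Pn_pos a m hx hφ, fun hE => ?_, fun hO => ?_⟩
  · simpa only [hE.neg_one_pow, one_mul] using hmono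
  · intro x hx y hy hxy
    have := hmono hx hy hxy
    simp only [hO.neg_one_pow] at this
    linarith
end

section
/- Let a_1 a_2 ⋯ be any infinite concatenation of the blocks '2' and '10' (i.e., a sequence over {0,1,2} obtained by concatenating copies of the words 2 and 10). Then −Σ_{j≥1} (a_j+1)/(−2)^j = 1 and, for every k ≥ 1, −Σ_{j≥1} (a_{k+j}+1)/(−2)^j ∈ [0,1]. In particular, uncountably many distinct sequences satisfy these equalities with β = 2. -/
open Filter Set

/-- If `v` is bounded and satisfies `v (k + 1) = a k + 1 - 2 * v k`, then `v k` is the value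
`-∑ (a (k + j) + 1) / (-2) ^ (j + 1)` of the `k`-th shift of `a`. -/
theorem neg_tsum_eq_of_recurrence {a v : ℕ → ℤ} (hv : ∀ n, v n = 0 ∨ v n = 1)
    (hrec : ∀ n, v (n + 1) = a n + 1 - 2 * v n) (k : ℕ) :
    -(∑' j : ℕ, ((a (k + j) : ℝ) + 1) / (-2 : ℝ) ^ (j + 1)) = v k := by
  have hf : Summable fun j : ℕ => (v (k + j) : ℝ) / (-2) ^ j := by
    refine Summable.of_norm_bounded (g := fun j : ℕ => (1 / 2 : ℝ) ^ j)
      (summable_geometric_of_lt_one (by norm_num) (by norm_num)) fun j => ?_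
    rcases hv (k + j) with h | h <;> simp [h]
  have hdiff := ((hasSum_nat_add_iff' 1).2 hf.hasSum).sub hf.hasSum
  have hterm : ∀ j : ℕ, ((a (k + j) : ℝ) + 1) / (-2 : ℝ) ^ (j + 1) =
      (v (k + (j + 1)) : ℝ) / (-2) ^ (j + 1) - (v (k + j) : ℝ) / (-2) ^ j := by
    intro j
    have h : (v (k + (j + 1)) : ℝ) = a (k + j) + 1 - 2 * v (k + j) := by
      exact_mod_cast hrec (k + j)
    have h2 : (-2 : ℝ) ^ j ≠ 0 := pow_ne_zero _ (by norm_num)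
    rw [h, pow_succ]
    field_simp
    ring
  simp_rw [hterm]
  rw [hdiff.tsum_eq]
  simp

theorem shift_conditions_of_recurrence {a v : ℕ → ℤ} (h0 : v 0 = 1)
    (hv : ∀ n, v n = 0 ∨ v n = 1) (hrec : ∀ n, v (n + 1) = a n + 1 - 2 * v n) :
    -(∑' j : ℕ, ((a j : ℝ) + 1) / (-2 : ℝ) ^ (j + 1)) = 1 ∧
      ∀ k : ℕ, 1 ≤ k →
        -(∑' j : ℕ, ((a (k + j) : ℝ) + 1) / (-2 : ℝ) ^ (j + 1)) ∈ Set.Icc (0 : ℝ) 1 := by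
  refine ⟨by simpa [h0] using neg_tsum_eq_of_recurrence hv hrec 0, fun k _ => ?_⟩
  rw [neg_tsum_eq_of_recurrence hv hrec k]
  rcases hv k with h | h <;> simp [h]

/-- The integer values of the shifts of `a`, when the value of `a` itself is `1`. -/
def shiftValue (a : ℕ → ℤ) : ℕ → ℤ
  | 0 => 1
  | n + 1 => a n + 1 - 2 * shiftValue a n

theorem shiftValue_eq_zero_or_one {a : ℕ → ℤ} (ha : IsInfConcat {[2], [1, 0]} a) (n : ℕ) :
    shiftValue a n = 0 ∨ shiftValue a n = 1 := by
  obtain ⟨w, hw, hcat⟩ := ha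
  have key : ∀ N, N ≤ (((List.range N).map w).flatten).length ∧
      shiftValue a (((List.range N).map w).flatten).length = 1 ∧
      ∀ i ≤ (((List.range N).map w).flatten).length,
        shiftValue a i = 0 ∨ shiftValue a i = 1 := by
    intro N
    induction N with
    | zero => simp [shiftValue]
    | succ N ih =>
      obtain ⟨hlen, hend, hall⟩ := ih
      have hc := hcat (N + 1)
      have happ : ((List.range (N + 1)).map w).flatten =
          ((List.range N).map w).flatten ++ w N := by
        simp [List.range_succ]
      rw [happ] at hc ⊢
      generalize ((List.range N).map w).flatten = l at *
      rcases hw N with h | h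
      · rw [h] at hc ⊢
        have ha0 : a l.length = 2 := by simpa using (hc l.length (by simp)).symm
        have h1 : shiftValue a (l.length + 1) = 1 := by simp [shiftValue, ha0, hend]
        simp only [List.length_append, List.length_cons, List.length_nil, zero_add]
        refine ⟨by omega, h1, fun i hi => ?_⟩
        rcases Nat.lt_or_eq_of_le hi with hi | rfl
        · exact hall i (by omega)
        · exact Or.inr h1
      · rw [Set.mem_singleton_iff.1 h] at hc ⊢
        have ha0 : a l.length = 1 := by simpa using (hc l.length (by simp)).symm
        have ha1 : a (l.length + 1) = 0 := by
          simpa using (hc (l.length + 1) (by simp)).symm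
        have h1 : shiftValue a (l.length + 1) = 0 := by simp [shiftValue, ha0, hend]
        have h2 : shiftValue a (l.length + 2) = 1 := by
          rw [shiftValue, h1, ha1]; norm_num
        simp only [List.length_append, List.length_cons, List.length_nil, zero_add,
          Nat.reduceAdd]
        refine ⟨by omega, h2, fun i hi => ?_⟩
        obtain hi | rfl | rfl : i ≤ l.length ∨ i = l.length + 1 ∨ i = l.length + 2 := by omega
        · exact hall i hi
        · exact Or.inl h1
        · exact Or.inr h2
  exact (key n).2.2 n (key n).1

/-- The concatenation of the blocks `22` (where `s` is true) and `10` (where `s` is false). -/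
def blockSeq (s : ℕ → Bool) (n : ℕ) : ℤ := if s (n / 2) then 2 else 1 - (n % 2 : ℕ)

theorem blockSeq_injective : Function.Injective blockSeq := by
  intro s t h
  funext n
  have := congrFun h (2 * n)
  cases hs : s n <;> cases ht : t n <;> simp_all [blockSeq]

theorem blockSeq_nonneg (s : ℕ → Bool) (n : ℕ) : 0 ≤ blockSeq s n := by
  unfold blockSeq
  split_ifs <;> omega

theorem blockSeq_shift_conditions (s : ℕ → Bool) :
    -(∑' j : ℕ, ((blockSeq s j : ℝ) + 1) / (-2 : ℝ) ^ (j + 1)) = 1 ∧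
      ∀ k : ℕ, 1 ≤ k →
        -(∑' j : ℕ, ((blockSeq s (k + j) : ℝ) + 1) / (-2 : ℝ) ^ (j + 1)) ∈
          Set.Icc (0 : ℝ) 1 := by
  refine shift_conditions_of_recurrence
    (v := fun n => if s (n / 2) then 1 else 1 - (n % 2 : ℕ)) (by simp) (fun n => ?_) fun n => ?_
  · split_ifs <;> omega
  · rcases Nat.even_or_odd' n with ⟨m, rfl | rfl⟩
    · have h1 : (2 * m + 1) / 2 = m := by omega
      have h2 : 2 * m / 2 = m := by omega
      simp only [blockSeq, h1, h2]
      split_ifs <;> omega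
    · have h1 : (2 * m + 1) / 2 = m := by omega
      have h2 : (2 * m + 1 + 1) / 2 = m + 1 := by omega
      simp only [blockSeq, h1, h2]
      split_ifs <;> omega

/-- every infinite concatenation of the blocks 2 and 10 satisfies
−Σ(a_j+1)/(−2)^j = 1 with all shifted sums in [0,1]; in particular uncountably
many sequences satisfy these equalities with β = 2. -/
theorem stmt_16 :
    (∀ a : ℕ → ℤ, IsInfConcat {[2], [1, 0]} a →
      -(∑' j : ℕ, ((a j : ℝ) + 1) / (-2 : ℝ) ^ (j + 1)) = 1 ∧
      ∀ k : ℕ, 1 ≤ k →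
        -(∑' j : ℕ, ((a (k + j) : ℝ) + 1) / (-2 : ℝ) ^ (j + 1)) ∈ Set.Icc (0 : ℝ) 1) ∧
    ¬ Set.Countable {a : ℕ → ℤ | (∀ n, 0 ≤ a n) ∧
      -(∑' j : ℕ, ((a j : ℝ) + 1) / (-2 : ℝ) ^ (j + 1)) = 1 ∧
      ∀ k : ℕ, 1 ≤ k →
        -(∑' j : ℕ, ((a (k + j) : ℝ) + 1) / (-2 : ℝ) ^ (j + 1)) ∈ Set.Icc (0 : ℝ) 1} := by
  refine ⟨fun a ha => shift_conditions_of_recurrence (v := shiftValue a) rfl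
    (shiftValue_eq_zero_or_one ha) fun _ => rfl, fun hS => ?_⟩
  have huniv : (Set.univ : Set (ℕ → Bool)).Countable :=
    (hS.preimage blockSeq_injective).mono fun s _ => by
      exact ⟨blockSeq_nonneg s, blockSeq_shift_conditions s⟩
  have : Uncountable (ℕ → Bool) := by
    rw [← Cardinal.aleph0_lt_mk_iff]
    simpa using Cardinal.cantor Cardinal.aleph0
  exact Set.not_countable_univ huniv
end

section
/- Let a_1 a_2 ⋯ be a sequence of non-negative integers satisfying (G), and suppose that for some k ≥ 1 the sequence a_1 a_2 ⋯ is an infinite concatenation of the blocks a_1⋯a_k and a_1⋯a_{k−1}(a_k−1)0. Then the periodic sequence (a_1⋯a_k)^∞ also satisfies (G), i.e., every shift of (a_1⋯a_k)^∞ is ≤_alt (a_1⋯a_k)^∞. -/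
open Filter Set

theorem AltLe.lt_of_lt_or_forall_eq {x y : ℕ → ℤ} (h : AltLe x y) (m : ℕ) :
    (∃ k, k < m ∧ (∀ i, i < k → x i = y i) ∧ (if Even k then x k < y k else y k < x k)) ∨
      ∀ i, i < m → x i = y i := by
  rcases h with ⟨k, hk, hlt⟩ | rfl
  · by_cases hkm : k < m
    · exact Or.inl ⟨k, hkm, hk, hlt⟩
    · exact Or.inr fun i hi => hk i (by omega)
  · exact Or.inr fun _ _ => rfl

theorem perSeq_map_range (a : ℕ → ℤ) {k : ℕ} (hk : 1 ≤ k) (n : ℕ) :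
    perSeq ((List.range k).map a) n = a (n % k) := by
  have h : n % k < k := Nat.mod_lt _ hk
  simp [perSeq, List.getD_eq_getElem?_getD, h]

theorem apply_length_flatten_add {a : ℕ → ℤ} {w : ℕ → List ℤ}
    (hw : ∀ N i, i < (((List.range N).map w).flatten).length →
      (((List.range N).map w).flatten).getD i 0 = a i)
    (N i : ℕ) (hi : i < (w N).length) :
    a ((((List.range N).map w).flatten).length + i) = (w N).getD i 0 := by
  have hsplit : ((List.range (N + 1)).map w).flatten =
      ((List.range N).map w).flatten ++ w N := by
    simp [List.range_succ]
  rw [← hw (N + 1) _ (by rw [hsplit, List.length_append]; omega), hsplit,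
    List.getD_append_right _ _ _ _ (by omega)]
  congr 1
  omega

/-- A concatenation of `a_1⋯a_k` and `a_1⋯a_{k−1}(a_k−1)0` is periodic unless the second
block occurs. -/
theorem IsInfConcat.periodic_or_exists_block {a : ℕ → ℤ} {k : ℕ} (hk : 1 ≤ k)
    (hcat : IsInfConcat
      {(List.range k).map a, (List.range (k - 1)).map a ++ [a (k - 1) - 1, 0]} a) :
    (∀ n, a n = a (n % k)) ∨
      ∃ N, (∀ i, i < k - 1 → a (N + i) = a i) ∧ a (N + (k - 1)) = a (k - 1) - 1 := by
  obtain ⟨w, hS, hw⟩ := hcat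
  by_cases hall : ∀ n, w n = (List.range k).map a
  · left
    have hlen : ∀ N, (((List.range N).map w).flatten).length = N * k := by
      intro N
      simp [List.length_flatten, Function.comp_def, hall]
    intro n
    have hn : n % k < k := Nat.mod_lt _ hk
    have h := apply_length_flatten_add hw (n / k) (n % k) (by simpa [hall] using hn)
    rw [hlen, Nat.div_add_mod', hall] at h
    simpa [List.getD_eq_getElem?_getD, hn] using h
  · right
    push Not at hall
    obtain ⟨N, hN⟩ := hall
    have hB : w N = (List.range (k - 1)).map a ++ [a (k - 1) - 1, 0] :=
      (hS N).resolve_left hN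
    refine ⟨(((List.range N).map w).flatten).length, fun i hi => ?_, ?_⟩
    · rw [apply_length_flatten_add hw N i (by simp [hB]; omega), hB,
        List.getD_append _ _ _ _ (by simpa using hi)]
      simp [List.getD_eq_getElem?_getD, hi]
    · rw [apply_length_flatten_add hw N (k - 1) (by simp [hB]), hB,
        List.getD_append_right _ _ _ _ (by simp)]
      simp

/-- If `a_1⋯a_{k−1}(a_k−1)` occurs in a sequence satisfying (G), then every border of
`a_1⋯a_k` has odd length. -/
theorem CondG.odd_of_border {a : ℕ → ℤ} (hG : CondG a) {j l N : ℕ} (hj : 1 ≤ j) (hl : 1 ≤ l)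
    (hN : ∀ i, i < j + l - 1 → a (N + i) = a i)
    (hlast : a (N + (j + l - 1)) = a (j + l - 1) - 1)
    (hborder : ∀ i, i < l → a (i + j) = a i) : ¬ Even l := by
  intro hl_even
  have hshift : ∀ i, i < l - 1 → a (i + (N + j)) = a i := by
    intro i hi
    rw [← hborder i (by omega), ← hN (i + j) (by omega)]
    congr 1
    omega
  have hend : a (l - 1 + (N + j)) = a (l - 1) - 1 := by
    rw [← hborder (l - 1) (by omega), show l - 1 + j = j + l - 1 by omega, ← hlast]
    congr 1
    omega
  have hodd : ¬ Even (l - 1) := by grind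
  rcases (hG (N + j) (by omega)).lt_of_lt_or_forall_eq l with ⟨i, hi, -, hlt⟩ | heq
  · rcases Nat.lt_or_ge i (l - 1) with hil | hil
    · have := hshift i hil
      split_ifs at hlt <;> omega
    · obtain rfl : i = l - 1 := by omega
      rw [if_neg hodd] at hlt
      omega
  · have := heq (l - 1) (by omega)
    omega

/-- if a satisfies (G) and is an infinite concatenation of the
blocks a_1⋯a_k and a_1⋯a_{k−1}(a_k−1)0, then (a_1⋯a_k)^∞ satisfies (G). -/
theorem stmt_17 (a : ℕ → ℤ) (hpos : ∀ n, 0 ≤ a n) (hG : CondG a) (k : ℕ) (hk : 1 ≤ k)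
    (hcat : IsInfConcat
      {(List.range k).map a, (List.range (k - 1)).map a ++ [a (k - 1) - 1, 0]} a) :
    CondG (perSeq ((List.range k).map a)) := by
  rcases hcat.periodic_or_exists_block hk with hper | ⟨N, hN, hlast⟩
  · have hp : perSeq ((List.range k).map a) = a := by
      funext n
      rw [perSeq_map_range a hk, ← hper]
    rwa [hp]
  have hp := perSeq_map_range a hk
  intro m _
  obtain ⟨j, hjm⟩ : ∃ j, j = m % k := ⟨_, rfl⟩
  have hjk : j < k := hjm ▸ Nat.mod_lt _ hk
  have hs : ∀ n, perSeq ((List.range k).map a) (n + m) = a ((n + j) % k) := by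
    intro n
    rw [hp, hjm, Nat.add_mod_mod]
  obtain ⟨l, rfl⟩ : ∃ l, k = j + l := ⟨k - j, by omega⟩
  have hwrap : ∀ i, (l + i + j) % (j + l) = i % (j + l) := by
    intro i
    rw [show l + i + j = i + (j + l) by omega, Nat.add_mod_right]
  rcases Nat.eq_zero_or_pos j with hj0 | hj
  · right
    funext n
    rw [hs, hp, hj0, Nat.add_zero]
  rcases (hG j hj).lt_of_lt_or_forall_eq l with ⟨i, hi, hpre, hlt⟩ | hborder
  · refine Or.inl ⟨i, fun t ht => ?_, ?_⟩
    · simp only [hs, hp]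
      rw [Nat.mod_eq_of_lt (by omega), Nat.mod_eq_of_lt (by omega)]
      exact hpre t ht
    · simp only [hs, hp]
      rwa [Nat.mod_eq_of_lt (by omega), Nat.mod_eq_of_lt (by omega)]
  have hodd : ¬ Even l := hG.odd_of_border hj (by omega) hN hlast hborder
  rcases (hG l (by omega)).lt_of_lt_or_forall_eq j with ⟨i, hi, hpre, hlt⟩ | hborder'
  · refine Or.inl ⟨l + i, fun t ht => ?_, ?_⟩
    · simp only [hs, hp]
      rw [Nat.mod_eq_of_lt (a := t) (by omega)]
      rcases Nat.lt_or_ge t l with htl | htl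
      · rw [Nat.mod_eq_of_lt (by omega)]
        exact hborder t htl
      · obtain ⟨r, rfl⟩ := Nat.exists_eq_add_of_le htl
        rw [hwrap, Nat.mod_eq_of_lt (by omega), Nat.add_comm l r]
        exact (hpre r (by omega)).symm
    · simp only [hs, hp]
      rw [hwrap, Nat.mod_eq_of_lt (by omega), Nat.mod_eq_of_lt (by omega), Nat.add_comm l i]
      by_cases hie : Even i
      · have : ¬ Even (i + l) := by grind
        rw [if_neg this]
        rwa [if_pos hie] at hlt
      · have : Even (i + l) := by grind
        rw [if_pos this]
        rwa [if_neg hie] at hlt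
  · right
    funext n
    rw [hs, hp, ← Nat.mod_add_mod n]
    have hn : n % (j + l) < j + l := Nat.mod_lt _ hk
    generalize n % (j + l) = t at hn
    rcases Nat.lt_or_ge t l with htl | htl
    · rw [Nat.mod_eq_of_lt (by omega)]
      exact hborder t htl
    · obtain ⟨r, rfl⟩ := Nat.exists_eq_add_of_le htl
      rw [hwrap, Nat.mod_eq_of_lt (by omega), Nat.add_comm l r]
      exact (hborder' r (by omega)).symm
end

section
/- Let a_1 a_2 ⋯ be a sequence of non-negative integers satisfying (G), and suppose that for some k ≥ 1 the sequence a_1 a_2 ⋯ is an infinite concatenation of the blocks a_1⋯a_k 0 and a_1⋯a_{k−1}(a_k+1), with a_1 a_2 ⋯ ≠ (a_1⋯a_k 0)^∞. Then the periodic sequence (a_1⋯a_{k−1}(a_k+1))^∞ also satisfies (G), i.e., every shift of (a_1⋯a_{k−1}(a_k+1))^∞ is ≤_alt (a_1⋯a_{k−1}(a_k+1))^∞. -/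
open Filter Set

/-- Comparing the first difference: a shift of a sequence satisfying (G) which agrees with the
sequence on the first `m` letters is correctly ordered at index `m`. -/
theorem CondG.le_at {a : ℕ → ℤ} (hG : CondG a) {s m : ℕ} (hs : 1 ≤ s)
    (h : ∀ i < m, a (s + i) = a i) :
    (Even m → a (s + m) ≤ a m) ∧ (¬ Even m → a m ≤ a (s + m)) := by
  rcases hG s hs with ⟨t, ht, hlt⟩ | heq
  · rcases lt_trichotomy t m with htm | rfl | htm
    · have h1 := h t htm
      rw [add_comm] at h1
      simp only [h1] at hlt
      split_ifs at hlt <;> omega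
    · simp only [add_comm t s] at hlt
      split_ifs at hlt with he
      · exact ⟨fun _ => hlt.le, fun h' => absurd he h'⟩
      · exact ⟨fun h' => absurd h' he, fun _ => hlt.le⟩
    · have h1 : a (m + s) = a m := ht m htm
      rw [add_comm] at h1
      exact ⟨fun _ => h1.le, fun _ => h1.ge⟩
  · have h1 := congrFun heq m
    simp only [add_comm m s] at h1
    exact ⟨fun _ => h1.le, fun _ => h1.ge⟩

/-- Each block of an infinite concatenation occurs at the end of the preceding blocks. -/
theorem eq_getD_of_flatten {w : ℕ → List ℤ} {a : ℕ → ℤ}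
    (h : ∀ N i, i < (((List.range N).map w).flatten).length →
      (((List.range N).map w).flatten).getD i 0 = a i) (m i : ℕ) (hi : i < (w m).length) :
    a ((((List.range m).map w).flatten).length + i) = (w m).getD i 0 := by
  have h1 := h (m + 1) ((((List.range m).map w).flatten).length + i)
  simp only [List.range_succ, List.map_append, List.flatten_append, List.map_cons, List.map_nil,
    List.flatten_cons, List.flatten_nil, List.append_nil] at h1
  rw [← h1 (by rw [List.length_append]; omega), List.getD_append_right _ _ _ _ (by omega)]
  congr 1
  omega

/-- An infinite concatenation of copies of one nonempty word is periodic. -/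
theorem eq_perSeq_of_flatten {w : ℕ → List ℤ} {a : ℕ → ℤ} {v : List ℤ} (hv : v ≠ [])
    (h : ∀ N i, i < (((List.range N).map w).flatten).length →
      (((List.range N).map w).flatten).getD i 0 = a i) (hw : ∀ n, w n = v) : a = perSeq v := by
  have hlen : ∀ m, (((List.range m).map w).flatten).length = v.length * m := by
    intro m
    induction m with
    | zero => simp
    | succ m ih =>
      rw [List.range_succ, List.map_append, List.flatten_append, List.length_append, ih]
      simp [hw, Nat.mul_succ]
  funext n
  have hn := eq_getD_of_flatten h (n / v.length) (n % v.length)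
    (by rw [hw]; exact Nat.mod_lt _ (List.length_pos_iff.2 hv))
  rw [hlen, hw, Nat.div_add_mod] at hn
  exact hn

section

variable {a b : ℕ → ℤ} {k n : ℕ}

/-- If a sequence `a` with (G) contains the word `b₀⋯b_{k-1}`, where `b` agrees with `a` before
index `k - 1`, then a suffix of that word is either smaller than the corresponding prefix or equal
to it. -/
theorem CondG.suffix_lt_or_eq (hG : CondG a) (hba : ∀ i < k - 1, b i = a i)
    (hblock : ∀ i < k, a (n + i) = b i) {s : ℕ} (hs : 1 ≤ s) :
    (∃ i < k - s, (∀ i' < i, b (s + i') = b i') ∧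
      (if Even i then b (s + i) < b i else b i < b (s + i))) ∨
    ∀ i < k - s, b (s + i) = b i := by
  classical
  by_cases hex : ∃ i, i < k - s ∧ b (s + i) ≠ b i
  · left
    obtain ⟨hlt, hne⟩ := Nat.find_spec hex
    have hmin : ∀ i' < Nat.find hex, b (s + i') = b i' := by
      intro i' hi'
      by_contra hcon
      exact Nat.find_min hex hi' ⟨by omega, hcon⟩
    generalize Nat.find hex = i at hlt hne hmin
    refine ⟨i, hlt, hmin, ?_⟩
    have key : ∀ i' ≤ i, a (n + s + i') = b (s + i') := fun i' hi' => by
      rw [add_assoc]; exact hblock _ (by omega)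
    have hle := hG.le_at (s := n + s) (m := i) (by omega) fun i' hi' => by
      rw [key i' hi'.le, hmin i' hi', hba i' (by omega)]
    rw [key i le_rfl, ← hba i (by omega)] at hle
    split_ifs with he
    · exact lt_of_le_of_ne (hle.1 he) hne
    · exact lt_of_le_of_ne (hle.2 he) hne.symm
  · right
    push Not at hex
    exact hex

/-- The word `b₀⋯b_{k-1} = a₀⋯a_{k-2}(a_{k-1}+1)`, if followed in `a` by `a₀⋯a_{k-2}`, has no
border of even length. -/
theorem CondG.odd_of_border_s18 (hG : CondG a) (hk : 1 ≤ k) (hba : ∀ i < k - 1, b i = a i)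
    (hlast : b (k - 1) = a (k - 1) + 1) (hblock : ∀ i < k, a (n + i) = b i)
    (hnext : ∀ i < k - 1, a (n + k + i) = a i) {j l : ℕ} (hj : 1 ≤ j) (hl : 1 ≤ l)
    (hjl : j + l = k) (hbord : ∀ i < l, b (j + i) = b i) : ¬ Even l := by
  intro hle
  have hcommon : ∀ i < j, a (l + i) = a i := by
    intro i
    induction i using Nat.strong_induction_on with
    | _ i ih =>
      intro hi
      have h1 := hG.le_at (s := l) (m := i) hl fun i' hi' => ih i' hi' (by omega)
      have h2 := hG.le_at (s := n + j) (m := l + i) (by omega) fun i' hi' => by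
        rcases lt_or_ge i' l with hil | hil
        · rw [add_assoc, hblock _ (by omega), hbord i' hil, hba _ (by omega)]
        · obtain ⟨c, rfl⟩ := Nat.exists_eq_add_of_le hil
          rw [show n + j + (l + c) = n + k + c by omega, hnext _ (by omega),
            ih c (by omega) (by omega)]
      rw [show n + j + (l + i) = n + k + i by omega, hnext _ (by omega), Nat.even_add] at h2
      by_cases he : Even i
      · exact le_antisymm (h1.1 he) (h2.1 (by simp [hle, he]))
      · exact le_antisymm (h2.2 (by simp [hle, he])) (h1.2 he)
  have hsumb : ∑ i ∈ Finset.range k, b i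
      = ∑ i ∈ Finset.range j, a i + ∑ i ∈ Finset.range l, a i := by
    rw [← hjl, Finset.sum_range_add]
    congr 1
    · exact Finset.sum_congr rfl fun i hi => hba i (by have := Finset.mem_range.1 hi; omega)
    · refine Finset.sum_congr rfl fun i hi => ?_
      have := Finset.mem_range.1 hi
      rw [hbord i this, hba i (by omega)]
  have hsuma : ∑ i ∈ Finset.range k, a i
      = ∑ i ∈ Finset.range l, a i + ∑ i ∈ Finset.range j, a i := by
    rw [← hjl, add_comm j l, Finset.sum_range_add]
    congr 1
    exact Finset.sum_congr rfl fun i hi => hcommon i (Finset.mem_range.1 hi)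
  have hsum : ∑ i ∈ Finset.range k, b i = ∑ i ∈ Finset.range k, a i + 1 := by
    obtain ⟨c, rfl⟩ : ∃ c, k = c + 1 := ⟨k - 1, by omega⟩
    simp only [Nat.add_sub_cancel] at hba hlast
    rw [Finset.sum_range_succ, Finset.sum_range_succ, hlast,
      Finset.sum_congr rfl fun i hi => hba i (Finset.mem_range.1 hi)]
    ring
  omega

/-- If `a` satisfies (G) and contains `a₀⋯a_{k-2}(a_{k-1}+1)` followed by `a₀⋯a_{k-2}`, then
the periodic repetition `b` of `a₀⋯a_{k-2}(a_{k-1}+1)` satisfies (G). -/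
theorem CondG.of_periodic (hG : CondG a) (hk : 1 ≤ k) (hper : Function.Periodic b k)
    (hba : ∀ i < k - 1, b i = a i) (hlast : b (k - 1) = a (k - 1) + 1)
    (hblock : ∀ i < k, a (n + i) = b i) (hnext : ∀ i < k - 1, a (n + k + i) = a i) :
    CondG b := by
  intro s _
  have hshift : (fun m => b (m + s)) = fun m => b (s % k + m) := by
    funext m
    rw [← hper.map_mod_nat (m + s), ← hper.map_mod_nat (s % k + m), Nat.mod_add_mod, add_comm]
  rw [hshift]
  have hjk : s % k < k := Nat.mod_lt _ hk
  generalize s % k = j at hjk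
  rcases Nat.eq_zero_or_pos j with rfl | hj
  · right
    simp
  obtain ⟨l, hjl⟩ := Nat.exists_eq_add_of_le hjk.le
  rcases hG.suffix_lt_or_eq hba hblock hj with ⟨i, -, hi, hlt⟩ | hbord
  · exact Or.inl ⟨i, hi, hlt⟩
  rw [show k - j = l by omega] at hbord
  have hodd := hG.odd_of_border_s18 hk hba hlast hblock hnext hj (by omega) hjl.symm hbord
  have hwrap : ∀ m, b (j + (l + m)) = b m := fun m => by
    rw [← add_assoc, ← hjl, add_comm, hper]
  rcases hG.suffix_lt_or_eq hba hblock (s := l) (by omega) with ⟨i, -, hi, hlt⟩ | hbord'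
  · refine Or.inl ⟨l + i, fun i' hi' => ?_, ?_⟩
    · rcases lt_or_ge i' l with hil | hil
      · exact hbord i' hil
      · obtain ⟨c, rfl⟩ := Nat.exists_eq_add_of_le hil
        exact (hwrap c).trans (hi c (by omega)).symm
    · simp only [hwrap, Nat.even_add, hodd, false_iff]
      by_cases he : Even i <;> simpa [he] using hlt
  · rw [show k - l = j by omega] at hbord'
    have hl_per : ∀ m, b (l + m) = b m := by
      intro m
      rw [← hper.map_mod_nat (l + m), ← hper.map_mod_nat m, ← Nat.add_mod_mod, hper.map_mod_nat]
      have hm : m % k < k := Nat.mod_lt _ hk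
      generalize m % k = r at hm
      rcases lt_or_ge r j with hrj | hrj
      · exact hbord' r hrj
      · obtain ⟨c, rfl⟩ := Nat.exists_eq_add_of_le hrj
        rw [add_left_comm, hwrap, hbord c (by omega)]
    right
    funext m
    rw [← hl_per (j + m), add_left_comm, hwrap]

end

/-- if a satisfies (G), is an infinite concatenation of the blocks
a_1⋯a_k0 and a_1⋯a_{k−1}(a_k+1), and differs from (a_1⋯a_k0)^∞, then
(a_1⋯a_{k−1}(a_k+1))^∞ satisfies (G). -/
theorem stmt_18 (a : ℕ → ℤ) (hpos : ∀ n, 0 ≤ a n) (hG : CondG a) (k : ℕ) (hk : 1 ≤ k)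
    (hcat : IsInfConcat
      {(List.range k).map a ++ [0], (List.range (k - 1)).map a ++ [a (k - 1) + 1]} a)
    (hneq : a ≠ perSeq ((List.range k).map a ++ [0])) :
    CondG (perSeq ((List.range (k - 1)).map a ++ [a (k - 1) + 1])) := by
  obtain ⟨w, hw, hflat⟩ := hcat
  set u := (List.range k).map a ++ [0] with hu
  set v := (List.range (k - 1)).map a ++ [a (k - 1) + 1] with hv
  have hvlen : v.length = k := by simp [hv]; omega
  have hupre : ∀ i < k - 1, u.getD i 0 = a i := fun i hi => by
    rw [hu, List.getD_append _ _ _ _ (by simp; omega)]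
    simp [List.getD_eq_getElem?_getD, show i < k by omega]
  have hvpre : ∀ i < k - 1, v.getD i 0 = a i := fun i hi => by
    rw [hv, List.getD_append _ _ _ _ (by simpa using hi)]
    simp [List.getD_eq_getElem?_getD, hi]
  have hvlast : v.getD (k - 1) 0 = a (k - 1) + 1 := by
    rw [hv, List.getD_append_right _ _ _ _ (by simp)]
    simp
  have hval : ∀ i < k, perSeq v i = v.getD i 0 := fun i hi => by
    rw [perSeq, hvlen, Nat.mod_eq_of_lt hi]
  obtain ⟨m, hm⟩ : ∃ m, w m = v := by
    by_contra! hcon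
    refine hneq (eq_perSeq_of_flatten (by simp [hu]) hflat fun n => ?_)
    exact (hw n).resolve_right (hcon n)
  have hlen : (((List.range (m + 1)).map w).flatten).length
      = (((List.range m).map w).flatten).length + k := by
    simp [List.range_succ, hm, hvlen]
  refine hG.of_periodic (n := (((List.range m).map w).flatten).length) hk ?_ ?_ ?_ ?_ ?_
  · intro i
    simp only [perSeq, hvlen, Nat.add_mod_right]
  · intro i hi
    rw [hval i (by omega), hvpre i hi]
  · rw [hval _ (by omega), hvlast]
  · intro i hi
    rw [eq_getD_of_flatten hflat m i (by rw [hm, hvlen]; exact hi), hm, hval i hi]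
  · intro i hi
    rw [← hlen]
    rcases hw (m + 1) with h | h
    · rw [eq_getD_of_flatten hflat _ i (by rw [h, hu]; simp; omega), h, hupre i hi]
    · rw [Set.mem_singleton_iff] at h
      rw [eq_getD_of_flatten hflat _ i (by rw [h, hvlen]; omega), h, hvpre i hi]
end

section
/- Let ℓ ≥ 1 and let Q(x) = Σ_{j=0}^{d} q_j (−x)^j be a polynomial with coefficients q_j ∈ {0,1}, leading coefficient q_d = 1, such that q_{j−1} = q_{j−2} = ⋯ = q_{j−ℓ+1} = 0 whenever q_j = 1 (for each j ≥ 1). If β > 1 satisfies Q(β) = 0, then β^{ℓ+1} < β + 1. -/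
open Filter Set

/-- Widening a bound on an initial sum across a block of vanishing coefficients. -/
lemma sum_mul_pow_lt_of_trailing_zeros {β : ℝ} (hβ : 1 < β) {r : ℕ → ℝ} {g h n : ℕ}
    (hh : 1 ≤ h)
    (hbound : ∀ m ≤ n, m + h ≤ n + 1 →
      (∑ j ∈ Finset.range m, r j * β ^ j) * (β ^ g - 1) * β < β ^ (m + g))
    (hzero : ∀ i < n, n < i + h → r i = 0) :
    (∑ j ∈ Finset.range n, r j * β ^ j) * (β ^ g - 1) * β ^ h < β ^ (n + g) := by
  have hpos : 0 < β := by linarith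
  have htrunc : ∑ j ∈ Finset.range n, r j * β ^ j
      = ∑ j ∈ Finset.range (n + 1 - h), r j * β ^ j := by
    symm
    apply Finset.sum_subset
    · intro i hi
      simp only [Finset.mem_range] at hi ⊢
      omega
    · intro i hi hi'
      simp only [Finset.mem_range] at hi hi'
      rw [hzero i hi (by omega), zero_mul]
  rw [htrunc]
  rcases le_or_gt h (n + 1) with hle | hlt
  · have hm := hbound (n + 1 - h) (by omega) (by omega)
    have hmul := mul_lt_mul_of_pos_right hm (pow_pos hpos (h - 1))
    rw [← pow_add, mul_assoc, ← pow_succ'] at hmul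
    rwa [show h - 1 + 1 = h by omega, show n + 1 - h + g + (h - 1) = n + g by omega] at hmul
  · rw [show n + 1 - h = 0 by omega]
    simp only [Finset.range_zero, Finset.sum_empty, zero_mul]
    positivity

/-- A sum of powers of `β` with exponents at mutual distance at least `g` is strictly
dominated by the corresponding geometric series. -/
lemma sum_mul_pow_lt_of_gap {β : ℝ} (hβ : 1 < β) {r : ℕ → ℝ} {g : ℕ} (hg : 1 ≤ g)
    (hr : ∀ j, r j = 0 ∨ r j = 1)
    (hgap : ∀ i j, i < j → j < i + g → r j = 1 → r i = 0) (n : ℕ) :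
    (∑ j ∈ Finset.range n, r j * β ^ j) * (β ^ g - 1) * β < β ^ (n + g) := by
  have hpos : 0 < β := by linarith
  induction n using Nat.strong_induction_on with
  | _ n ih =>
    rcases n with _ | n
    · simp only [Finset.range_zero, Finset.sum_empty, zero_mul]
      positivity
    · rw [Finset.sum_range_succ]
      rcases hr n with h0 | h1
      · have hn := ih n (by omega)
        rw [h0, zero_mul, add_zero]
        exact hn.trans (pow_lt_pow_right₀ hβ (by omega))
      · have hn := sum_mul_pow_lt_of_trailing_zeros (g := g) hβ hg
          (fun m hm _ => ih m (by omega)) (fun i hi hni => hgap i n hi hni h1)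
        have hlt : (∑ j ∈ Finset.range n, r j * β ^ j) * (β ^ g - 1) < β ^ n := by
          rw [pow_add] at hn
          exact lt_of_mul_lt_mul_right hn (by positivity)
        have hmul := mul_lt_mul_of_pos_right hlt hpos
        rw [h1, one_mul]
        calc _ = (∑ j ∈ Finset.range n, r j * β ^ j) * (β ^ g - 1) * β
              + β ^ n * (β ^ g - 1) * β := by ring
          _ < β ^ n * β + β ^ n * (β ^ g - 1) * β := by linarith
          _ = β ^ (n + 1 + g) := by ring

/-- At a zero of an alternating sum, the leading power is at most the sum of the powers
whose exponents have the opposite parity. -/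
lemma pow_le_sum_opposite_parity {β : ℝ} (hβ : 0 ≤ β) {q : ℕ → ℕ} {d : ℕ} (hqd : q d = 1)
    (hQ : (∑ j ∈ Finset.range (d + 1), (q j : ℝ) * (-β) ^ j) = 0) :
    β ^ d ≤ ∑ j ∈ Finset.range d, (if Odd (j + d) then (q j : ℝ) else 0) * β ^ j := by
  have hsum : β ^ d + ∑ j ∈ Finset.range d, (-1) ^ d * ((q j : ℝ) * (-β) ^ j) = 0 := by
    rw [Finset.sum_range_succ, hqd] at hQ
    have hsq : ((-1 : ℝ) ^ d) * (-β) ^ d = β ^ d := by rw [← mul_pow]; simp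
    rw [← Finset.mul_sum, ← hsq]
    push_cast at hQ
    linear_combination (-1) ^ d * hQ
  have hterm : 0 ≤ ∑ j ∈ Finset.range d, ((-1) ^ d * ((q j : ℝ) * (-β) ^ j)
      + (if Odd (j + d) then (q j : ℝ) else 0) * β ^ j) := by
    refine Finset.sum_nonneg fun j _ => ?_
    have hsign : (-1 : ℝ) ^ d * ((q j : ℝ) * (-β) ^ j)
        = (-1) ^ (j + d) * ((q j : ℝ) * β ^ j) := by
      rw [neg_pow β j]; ring
    rw [hsign]
    split_ifs with hodd
    · rw [hodd.neg_one_pow]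
      linarith
    · rw [(Nat.not_odd_iff_even.mp hodd).neg_one_pow]
      positivity
  rw [Finset.sum_add_distrib] at hterm
  linarith

/-- if Q(x) = Σ_{j=0}^d q_j(−x)^j has coefficients in {0,1},
leading coefficient q_d = 1, any two 1-coefficients at distance ≥ ℓ, and
Q(β) = 0 for some β > 1, then β^{ℓ+1} < β + 1. -/
theorem stmt_19 (ℓ d : ℕ) (hℓ : 1 ≤ ℓ) (q : ℕ → ℕ)
    (hq01 : ∀ j, q j = 0 ∨ q j = 1) (hqd : q d = 1)
    (hgap : ∀ i j : ℕ, i < j → j < i + ℓ → q j = 1 → q i = 0)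
    (β : ℝ) (hβ : 1 < β)
    (hQ : (∑ j ∈ Finset.range (d + 1), (q j : ℝ) * (-β) ^ j) = 0) :
    β ^ (ℓ + 1) < β + 1 := by
  have hpos : 0 < β := by linarith
  set r : ℕ → ℝ := fun j => if Odd (j + d) then (q j : ℝ) else 0 with hr
  have hr_one : ∀ j, r j = 1 → Odd (j + d) ∧ q j = 1 := by
    intro j hj
    simp only [hr] at hj
    split_ifs at hj with hodd
    · exact ⟨hodd, by exact_mod_cast hj⟩
    · norm_num at hj
  have hr01 : ∀ j, r j = 0 ∨ r j = 1 := by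
    intro j
    rcases hq01 j with hj | hj <;> by_cases hodd : Odd (j + d) <;> simp [hr, hj, hodd]
  have hlead : β ^ d ≤ ∑ j ∈ Finset.range d, r j * β ^ j :=
    pow_le_sum_opposite_parity hpos.le hqd hQ
  have key : ∀ g h : ℕ, 1 ≤ g → 1 ≤ h →
      (∀ i j, i < j → j < i + g → r j = 1 → r i = 0) →
      (∀ i < d, d < i + h → r i = 0) → (β ^ g - 1) * β ^ h < β ^ g := by
    intro g h hg hh hsame hopp
    have hlt := sum_mul_pow_lt_of_trailing_zeros (g := g) hβ hh
      (fun m _ _ => sum_mul_pow_lt_of_gap hβ hg hr01 hsame m) hopp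
    have hc : 0 ≤ (β ^ g - 1) * β ^ h :=
      mul_nonneg (by linarith [one_le_pow₀ (n := g) hβ.le]) (by positivity)
    have hle := mul_le_mul_of_nonneg_right hlead hc
    rw [mul_assoc, pow_add] at hlt
    exact lt_of_mul_lt_mul_left (hle.trans_lt hlt) (by positivity)
  have hr_zero : ∀ i, (Odd (i + d) → q i = 0) → r i = 0 := by
    intro i hi
    by_cases hodd : Odd (i + d)
    · simp [hr, hi hodd]
    · simp [hr, hodd]
  rcases Nat.even_or_odd ℓ with hev | hod
  · have hk := key ℓ (ℓ + 1) hℓ (by omega)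
      (fun i j hij hji hj => hr_zero i fun _ => hgap i j hij hji (hr_one j hj).2)
      (fun i hi hdi => hr_zero i fun hodd => by
        refine hgap i d hi ?_ hqd
        rw [Nat.odd_iff] at hodd
        rw [Nat.even_iff] at hev
        omega)
    have hfac : β ^ ℓ * β ^ (ℓ + 1) < β ^ ℓ * (β + 1) := by
      linear_combination hk
    exact lt_of_mul_lt_mul_left hfac (by positivity)
  · have hk := key (ℓ + 1) ℓ (by omega) hℓ
      (fun i j hij hji hj => hr_zero i fun hodd => by
        have hjodd := (hr_one j hj).1
        refine hgap i j hij ?_ (hr_one j hj).2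
        rw [Nat.odd_iff] at hodd hjodd hod
        omega)
      (fun i hi hdi => hr_zero i fun _ => hgap i d hi hdi hqd)
    have hfac : β ^ ℓ * β ^ (ℓ + 1) < β ^ ℓ * (β + 1) := by
      linear_combination hk
    exact lt_of_mul_lt_mul_left hfac (by positivity)
end
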